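/- arXiv:0806.4421 — 6 statements merged into one kernel-verified Lean document; each statement's English description precedes it below -/
import Mathlib

section
/- Let K ⊆ L be finite fields with |K| = q and [L : K] = n, and let m ≥ 1 be a natural number. Then the number of x ∈ Lˣ such that x^m generates L over K is at least (q^n − 1) − m·∑_{d ∣ n, d < n} (q^d − 1). -/
open Finset in
/-- For finite fields `K ⊆ L` with `|K| = q`, `[L : K] = n`, and `m ≥ 1`, the number of
`x ∈ Lˣ` such that `x^m` generates `L` over `K` is at least
`(q^n - 1) - m * ∑_{d ∣ n, d < n} (q^d - 1)`. -/
theorem stmt_2 (K L : Type*) [Field K] [Field L] [Algebra K L]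
    [Fintype K] [Fintype L] (q n m : ℕ) (hm : 1 ≤ m) (hq : Fintype.card K = q)
    (hrank : Module.finrank K L = n) :
    ((q : ℤ) ^ n - 1) - m * ∑ d ∈ n.divisors.filter (fun d => d < n), ((q : ℤ) ^ d - 1) ≤
      Nat.card {x : Lˣ // Algebra.adjoin K {((x ^ m : Lˣ) : L)} = ⊤} := by
  classical
  have hfin : FiniteDimensional K L := Module.Finite.of_finite
  have hq1 : 1 < q := hq ▸ Fintype.one_lt_card
  have hn : 0 < n := hrank ▸ Module.finrank_pos
  have hcardL : Fintype.card L = q ^ n := by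
    rw [Module.card_eq_pow_finrank (K := K), hq, hrank]
  have hU : Fintype.card Lˣ = q ^ n - 1 := by rw [Fintype.card_units, hcardL]
  have hone : ∀ d, 1 ≤ q ^ d := fun d => Nat.one_le_pow _ _ (by omega)
  rw [Nat.card_eq_fintype_card, Fintype.card_subtype]
  set D := n.divisors.filter (fun d => d < n) with hD
  have hsub : (univ.filter fun x : Lˣ => ¬ Algebra.adjoin K {((x ^ m : Lˣ) : L)} = ⊤) ⊆
      D.biUnion (fun d => univ.filter fun x : Lˣ => x ^ (m * (q ^ d - 1)) = 1) := by
    intro x hx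
    simp only [mem_filter, mem_univ, true_and] at hx
    set y : L := ((x ^ m : Lˣ) : L) with hy
    have hint : IsAlgebraic K y := Algebra.IsAlgebraic.isAlgebraic y
    let F := IntermediateField.adjoin K {y}
    have hF : F.toSubalgebra = Algebra.adjoin K {y} :=
      IntermediateField.adjoin_simple_toSubalgebra_of_isAlgebraic hint
    have hdvd : Module.finrank K F ∣ n := ⟨_, by rw [← hrank, Module.finrank_mul_finrank K F L]⟩
    have hne : Module.finrank K F ≠ n := by
      intro h
      apply hx
      rw [← hF]
      have : F = ⊤ := IntermediateField.eq_of_le_of_finrank_eq le_top (by rw [IntermediateField.finrank_top', h, hrank])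
      rw [this]; rfl
    simp only [mem_biUnion, mem_filter, mem_univ, true_and, hD, Nat.mem_divisors]
    refine ⟨Module.finrank K F, ⟨⟨hdvd, hn.ne'⟩, lt_of_le_of_ne (Nat.le_of_dvd hn hdvd) hne⟩, ?_⟩
    have hyF : y ∈ F := IntermediateField.mem_adjoin_simple_self K y
    have hFc : Fintype.card F = q ^ Module.finrank K F := by
      rw [Module.card_eq_pow_finrank (K := K), hq]
    have hy0 : (⟨y, hyF⟩ : F) ≠ 0 := by
      intro h
      exact (x ^ m).ne_zero (congrArg Subtype.val h)
    have h1 := FiniteField.pow_card_sub_one_eq_one (⟨y, hyF⟩ : F) hy0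
    have h2 : y ^ (Fintype.card F - 1) = 1 := congrArg Subtype.val h1
    rw [hFc] at h2
    rw [pow_mul]
    ext
    rw [Units.val_pow_eq_pow_val]
    exact h2
  have hbad : (univ.filter fun x : Lˣ => ¬ Algebra.adjoin K {((x ^ m : Lˣ) : L)} = ⊤).card ≤
      ∑ d ∈ D, m * (q ^ d - 1) := by
    refine (card_le_card hsub).trans (card_biUnion_le.trans (sum_le_sum fun d hd => ?_))
    have hd0 : d ≠ 0 := by
      have := (mem_filter.mp hd).1
      exact (Nat.pos_of_mem_divisors this).ne'
    have : 1 < q ^ d := Nat.one_lt_pow hd0 hq1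
    exact IsCyclic.card_pow_eq_one_le (Nat.mul_pos (by omega) (by omega))
  have htot := card_filter_add_card_filter_not (s := (univ : Finset Lˣ))
    (fun x : Lˣ => Algebra.adjoin K {((x ^ m : Lˣ) : L)} = ⊤)
  rw [card_univ, hU] at htot
  have hcast : ((∑ d ∈ D, m * (q ^ d - 1) : ℕ) : ℤ) = m * ∑ d ∈ D, ((q : ℤ) ^ d - 1) := by
    rw [mul_sum]
    push_cast [hone]
    rfl
  have hn' : ((q ^ n - 1 : ℕ) : ℤ) = (q : ℤ) ^ n - 1 := by
    push_cast [hone]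
    rfl
  rw [← hcast, ← hn']
  omega
end

section
/- Let ℓ be a prime, let d ≥ 1 be a natural number, let f ∈ ℤ[t] be a monic polynomial, and let g ∈ ℤ_ℓ[t] be a monic polynomial such that the image of f in ℤ_ℓ[t] equals g^d. Then there exists a monic polynomial g₀ ∈ ℤ[t] such that g is the image of g₀ in ℤ_ℓ[t] and f = g₀^d in ℤ[t]. -/
open Polynomial in
theorem aux_field {F K : Type*} [Field F] [CharZero F] [Field K] (φ : F →+* K) (d : ℕ) (hd : 1 ≤ d) :
    ∀ (n : ℕ) (f : F[X]) (g : K[X]), f.natDegree = n → f.Monic → g.Monic → f.map φ = g ^ d →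
      ∃ g₀ : F[X], g₀.Monic ∧ g₀.map φ = g := by
  intro n
  induction n using Nat.strong_induction_on with
  | _ n ih =>
  intro f g hn hf hg h
  by_cases hu : IsUnit f
  · have hf1 : f = 1 := hf.eq_one_of_isUnit hu
    refine ⟨1, monic_one, ?_⟩
    have : IsUnit g := by
      have h1 : IsUnit (g ^ d) := by rw [← h, hf1]; simp
      exact (isUnit_pow_iff (by omega)).1 h1
    rw [hg.eq_one_of_isUnit this]; simp
  · obtain ⟨p, hpm, hp, hpf⟩ := exists_monic_irreducible_factor f hu
    have hsq : Squarefree (p.map φ) := (hp.separable.map (f := φ)).squarefree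
    have hdvd : p.map φ ∣ g := by
      have : p.map φ ∣ g ^ d := h ▸ Polynomial.map_dvd φ hpf
      exact hsq.isRadical d g this
    obtain ⟨g', rfl⟩ := hdvd
    have hpow : p ^ d ∣ f := by
      rw [← Polynomial.map_dvd_map' φ, h, Polynomial.map_pow]
      exact pow_dvd_pow_of_dvd (Dvd.intro _ rfl) d
    obtain ⟨f', rfl⟩ := hpow
    have hpφ := hpm.map φ
    have hg' : g'.Monic := hpφ.of_mul_monic_left hg
    have hf' : f'.Monic := (hpm.pow d).of_mul_monic_left hf
    have hdeg := hp.natDegree_pos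
    rw [(hpm.pow d).natDegree_mul hf', hpm.natDegree_pow] at hn
    have hpos : 0 < d * p.natDegree := Nat.mul_pos hd hdeg
    obtain ⟨g₀, h1, h2⟩ := ih f'.natDegree (by omega) f' g' rfl hf' hg' (by
      rw [Polynomial.map_mul, Polynomial.map_pow, mul_pow] at h
      exact mul_left_cancel₀ (pow_ne_zero d hpφ.ne_zero) h)
    exact ⟨p * g₀, hpm.mul h1, by rw [Polynomial.map_mul, h2]⟩


/-- If a monic `f ∈ ℤ[t]` becomes a `d`-th power `g^d` of a monic `g` over `ℤ_ℓ`,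
then `g` comes from a monic integer polynomial `g₀` with `f = g₀^d` in `ℤ[t]`. -/
theorem stmt_4 (ℓ : ℕ) [Fact ℓ.Prime] (d : ℕ) (hd : 1 ≤ d)
    (f : Polynomial ℤ) (hf : f.Monic) (g : Polynomial ℤ_[ℓ]) (hg : g.Monic)
    (h : f.map (Int.castRingHom ℤ_[ℓ]) = g ^ d) :
    ∃ g₀ : Polynomial ℤ, g₀.Monic ∧ g₀.map (Int.castRingHom ℤ_[ℓ]) = g ∧ f = g₀ ^ d := by
  have hφ : ((Rat.castHom ℚ_[ℓ]).comp (Int.castRingHom ℚ)) =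
      (PadicInt.Coe.ringHom (p := ℓ)).comp (Int.castRingHom ℤ_[ℓ]) := RingHom.ext_int _ _
  have hinj : Function.Injective (PadicInt.Coe.ringHom (p := ℓ)) := Subtype.val_injective
  have hQ : (f.map (Int.castRingHom ℚ)).map (Rat.castHom ℚ_[ℓ]) =
      (g.map PadicInt.Coe.ringHom) ^ d := by
    rw [Polynomial.map_map, hφ, ← Polynomial.map_map, h, Polynomial.map_pow]
  obtain ⟨q, hq, hqg⟩ := aux_field (Rat.castHom ℚ_[ℓ]) d hd _ _ _ rfl (hf.map _) (hg.map _) hQ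
  have hqd : q ∣ f.map (algebraMap ℤ ℚ) := by
    rw [← Polynomial.map_dvd_map' (Rat.castHom ℚ_[ℓ])]
    change _ ∣ (f.map (Int.castRingHom ℚ)).map (Rat.castHom ℚ_[ℓ])
    rw [hQ, hqg]
    exact dvd_pow_self _ (by omega)
  obtain ⟨g₀, hg₀⟩ := IsIntegrallyClosed.eq_map_mul_C_of_dvd ℚ hf hqd
  rw [hq.leadingCoeff, Polynomial.C_1, mul_one] at hg₀
  have hm : g₀.Monic := by
    refine Polynomial.monic_of_injective (f := algebraMap ℤ ℚ) Int.cast_injective ?_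
    rw [hg₀]; exact hq
  have hmap : g₀.map (Int.castRingHom ℤ_[ℓ]) = g := by
    apply Polynomial.map_injective _ hinj
    rw [Polynomial.map_map, ← hφ, ← Polynomial.map_map, ← hqg, ← hg₀]
    rfl
  refine ⟨g₀, hm, hmap, ?_⟩
  apply Polynomial.map_injective (Int.castRingHom ℤ_[ℓ]) Int.cast_injective
  rw [h, Polynomial.map_pow, hmap]
end

section
/- Let G₁, …, G_n be finite perfect groups such that for each i the quotient G_i/Z(G_i) of G_i by its center is a nonabelian simple group, and such that for i ≠ j the groups G_i/Z(G_i) and G_j/Z(G_j) are not isomorphic. If H is a subgroup of the direct product G₁ × ⋯ × G_n whose projection to each factor G_i is surjective, then H = G₁ × ⋯ × G_n. -/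
open scoped commutatorElement in
lemma aux_normal {G : Type*} [Group G] (hp : commutator G = ⊤)
    (hs : IsSimpleGroup (G ⧸ Subgroup.center G)) (N : Subgroup G) [hN : N.Normal] :
    N ≤ Subgroup.center G ∨ N = ⊤ := by
  have hn : (N.map (QuotientGroup.mk' (Subgroup.center G))).Normal :=
    hN.map _ (QuotientGroup.mk'_surjective _)
  rcases hs.eq_bot_or_eq_top_of_normal _ hn with h | h
  · left
    rw [Subgroup.map_eq_bot_iff, QuotientGroup.ker_mk'] at h
    exact h
  · right
    have key : ∀ g : G, ∃ a ∈ N, ∃ z ∈ Subgroup.center G, g = a * z := by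
      intro g
      have hg : (QuotientGroup.mk' (Subgroup.center G) g) ∈
        N.map (QuotientGroup.mk' (Subgroup.center G)) := by rw [h]; trivial
      obtain ⟨a, ha, hag⟩ := hg
      refine ⟨a, ha, a⁻¹ * g, ?_, by group⟩
      exact QuotientGroup.eq.1 hag
    rw [eq_top_iff, ← hp, commutator_def, Subgroup.commutator_le]
    intro g _ k _
    obtain ⟨a, ha, z, hz, rfl⟩ := key g
    obtain ⟨b, hb, w, hw, rfl⟩ := key k
    have e1 : ∀ x, x * z = z * x := Subgroup.mem_center_iff.1 hz
    have e2 : ∀ x, x * w = w * x := Subgroup.mem_center_iff.1 hw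
    have : ⁅a * z, b * w⁆ = ⁅a, b⁆ := by
      rw [commutatorElement_def, commutatorElement_def]
      have : a * z * (b * w) = a * b * (w * z) := by
        rw [mul_assoc a z, ← e1 (b * w)]; group
      have h2 : b * w * (a * z) = b * a * (w * z) := by
        rw [mul_assoc b w, ← mul_assoc w, ← e2 a]; group
      calc a * z * (b * w) * (a * z)⁻¹ * (b * w)⁻¹
          = (a * z * (b * w)) * (b * w * (a * z))⁻¹ := by group
        _ = _ := by rw [this, h2]; group
    rw [this, commutatorElement_def]
    exact N.mul_mem (N.mul_mem (N.mul_mem ha hb) (N.inv_mem ha)) (N.inv_mem hb)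

lemma aux_pair {A G G' : Type*} [Group A] [Group G] [Group G']
    (hp : commutator G = ⊤) (hp' : commutator G' = ⊤)
    (hs : IsSimpleGroup (G ⧸ Subgroup.center G))
    (hs' : IsSimpleGroup (G' ⧸ Subgroup.center G'))
    (hna : ∃ a b : G ⧸ Subgroup.center G, a * b ≠ b * a)
    (he : IsEmpty ((G ⧸ Subgroup.center G) ≃* (G' ⧸ Subgroup.center G')))
    (p : A →* G) (q : A →* G') (hps : Function.Surjective p) (hqs : Function.Surjective q) :
    q.ker.map p = ⊤ := by
  have hn : (q.ker.map p).Normal := (inferInstance : q.ker.Normal).map p hps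
  rcases aux_normal hp hs (q.ker.map p) with h | h
  swap
  · exact h
  exfalso
  set r : A →* G ⧸ Subgroup.center G := (QuotientGroup.mk' _).comp p with hr
  set r' : A →* G' ⧸ Subgroup.center G' := (QuotientGroup.mk' _).comp q with hr'
  have hrs : Function.Surjective r := (QuotientGroup.mk'_surjective _).comp hps
  have hrs' : Function.Surjective r' := (QuotientGroup.mk'_surjective _).comp hqs
  have mr : ∀ x, x ∈ r.ker ↔ p x ∈ Subgroup.center G := fun x => by
    rw [MonoidHom.mem_ker]; exact QuotientGroup.eq_one_iff _
  have mr' : ∀ x, x ∈ r'.ker ↔ q x ∈ Subgroup.center G' := fun x => by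
    rw [MonoidHom.mem_ker]; exact QuotientGroup.eq_one_iff _
  have hle : q.ker ≤ r.ker := fun x hx => (mr x).2 (h ⟨x, hx, rfl⟩)
  have hcen : Subgroup.center (G ⧸ Subgroup.center G) = ⊥ := by
    rcases hs.eq_bot_or_eq_top_of_normal (Subgroup.center (G ⧸ Subgroup.center G))
      inferInstance with h1 | h1
    · exact h1
    · obtain ⟨a, b, hab⟩ := hna
      have hb : b ∈ Subgroup.center (G ⧸ Subgroup.center G) := by rw [h1]; trivial
      exact absurd (Subgroup.mem_center_iff.1 hb a) hab
  have hker : r.ker = r'.ker := by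
    apply le_antisymm
    · have hn2 : (r.ker.map q).Normal := (inferInstance : r.ker.Normal).map q hqs
      rcases aux_normal hp' hs' (r.ker.map q) with h1 | h1
      · exact fun x hx => (mr' x).2 (h1 ⟨x, hx, rfl⟩)
      · exfalso
        have : ∀ x, r x = 1 := by
          intro x
          have hx : q x ∈ r.ker.map q := by rw [h1]; trivial
          obtain ⟨y, hy, hyx⟩ := hx
          have h2 : y⁻¹ * x ∈ q.ker := by rw [MonoidHom.mem_ker]; simp [hyx]
          have h3 := r.ker.mul_mem hy (hle h2)
          simpa using h3
        obtain ⟨a, b, hab⟩ := hna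
        obtain ⟨a, rfl⟩ := hrs a
        obtain ⟨b, rfl⟩ := hrs b
        simp [this] at hab
    · intro x hx
      have hx := (mr' x).1 hx
      rw [MonoidHom.mem_ker, ← Subgroup.mem_bot, ← hcen, Subgroup.mem_center_iff]
      intro g
      obtain ⟨y, rfl⟩ := hrs g
      have h1 : (y * x) * (x * y)⁻¹ ∈ q.ker := by
        rw [MonoidHom.mem_ker, map_mul, map_inv, mul_inv_eq_one, map_mul, map_mul]
        exact Subgroup.mem_center_iff.1 hx _
      have h2 := hle h1
      rwa [MonoidHom.mem_ker, map_mul, map_inv, mul_inv_eq_one, map_mul, map_mul] at h2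
  exact he.false (((QuotientGroup.quotientKerEquivOfSurjective r hrs).symm.trans
    (QuotientGroup.quotientMulEquivOfEq hker)).trans
    (QuotientGroup.quotientKerEquivOfSurjective r' hrs'))

/-- Goursat/Ribet/Chavdarov: a subgroup of a product of finite perfect groups with
distinct nonabelian simple central quotients, surjecting onto each factor, is everything. -/
theorem stmt_8 (n : ℕ) (G : Fin n → Type*) [∀ i, Group (G i)] [∀ i, Finite (G i)]
    (hperf : ∀ i, commutator (G i) = ⊤)
    (hsimple : ∀ i, IsSimpleGroup ((G i) ⧸ Subgroup.center (G i)))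
    (hnonab : ∀ i, ∃ a b : (G i) ⧸ Subgroup.center (G i), a * b ≠ b * a)
    (hdistinct : ∀ i j, i ≠ j →
      IsEmpty (((G i) ⧸ Subgroup.center (G i)) ≃* ((G j) ⧸ Subgroup.center (G j))))
    (H : Subgroup (∀ i, G i))
    (hsurj : ∀ i, Function.Surjective ((Pi.evalMonoidHom G i).comp H.subtype)) :
    H = ⊤ := by
  have key : ∀ i, ∀ S : Finset (Fin n), i ∉ S → ∃ N : Subgroup H, N.Normal ∧
      (∀ x ∈ N, ∀ j ∈ S, (x : ∀ i, G i) j = 1) ∧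
      N.map ((Pi.evalMonoidHom G i).comp H.subtype) = ⊤ := by
    intro i S
    induction S using Finset.induction_on with
    | empty =>
      intro _
      exact ⟨⊤, inferInstance, by simp, Subgroup.map_top_of_surjective _ (hsurj i)⟩
    | insert j S hj ih =>
      intro hi
      rw [Finset.mem_insert, not_or] at hi
      obtain ⟨N, hN, hN1, hN2⟩ := ih hi.2
      have hpair := aux_pair (hperf i) (hperf j) (hsimple i) (hsimple j) (hnonab i)
        (hdistinct i j hi.1) _ _ (hsurj i) (hsurj j)
      refine ⟨⁅N, ((Pi.evalMonoidHom G j).comp H.subtype).ker⁆, inferInstance, ?_, ?_⟩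
      · intro x hx k hk
        have hx := Subgroup.commutator_le_inf _ _ hx
        rcases Finset.mem_insert.1 hk with rfl | hk
        · exact hx.2
        · exact hN1 x hx.1 k hk
      · rw [Subgroup.map_commutator, hN2, hpair, ← commutator_def, hperf]
  rw [eq_top_iff]
  intro f _
  refine Subgroup.pi_mem_of_mulSingle_mem f fun i => ?_
  obtain ⟨N, -, h1, h2⟩ := key i (Finset.univ.erase i) (by simp)
  have hf : f i ∈ N.map ((Pi.evalMonoidHom G i).comp H.subtype) := by rw [h2]; trivial
  obtain ⟨x, hx, hxf⟩ := hf
  have : Pi.mulSingle i (f i) = (x : ∀ i, G i) := by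
    funext j
    by_cases hj : j = i
    · subst hj
      rw [Pi.mulSingle_eq_same]; exact hxf.symm
    · rw [Pi.mulSingle_eq_of_ne hj, h1 x hx j (by simp [hj])]
  rw [this]
  exact x.2
end

section
/- Let G be a finite group with derived (commutator) subgroup D. Assume that D is perfect, that D/Z(D) is a nonabelian simple group, and that Z(D) = D ∩ Z(G). Let H ≤ G be a subgroup such that the image of H in G/Z(G) contains the image of D in G/Z(G). Then D ≤ H. -/
/-- If the derived subgroup `D` of a finite group `G` is perfect, `D/Z(D)` is nonabelian
simple, `Z(D) = D ∩ Z(G)`, and the image of `H ≤ G` in `G/Z(G)` contains the image of `D`,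
then `D ≤ H`. -/
theorem stmt_10 (G : Type*) [Group G] [Finite G] (D H : Subgroup G)
    (hD : D = commutator G)
    (hperf : ⁅D, D⁆ = D)
    (hsimple : IsSimpleGroup (D ⧸ Subgroup.center D))
    (hnonab : ∃ a b : D ⧸ Subgroup.center D, a * b ≠ b * a)
    (hZ : ∀ d : D, d ∈ Subgroup.center D ↔ (d : G) ∈ Subgroup.center G)
    (him : Subgroup.map (QuotientGroup.mk' (Subgroup.center G)) D ≤
      Subgroup.map (QuotientGroup.mk' (Subgroup.center G)) H) :
    D ≤ H := by
  have key : ∀ d ∈ D, ∃ h ∈ H, ∃ z ∈ Subgroup.center G, d = h * z := by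
    intro d hd
    obtain ⟨h, hh, e⟩ := him (Subgroup.mem_map_of_mem _ hd)
    exact ⟨h, hh, h⁻¹ * d, QuotientGroup.eq.1 e, by group⟩
  rw [← hperf, Subgroup.commutator_le]
  intro a ha b hb
  obtain ⟨h, hh, z, hz, rfl⟩ := key a ha
  obtain ⟨k, hk, w, hw, rfl⟩ := key b hb
  rw [Subgroup.mem_center_iff] at hz hw
  have e : h * z * (k * w) * (h * z)⁻¹ * (k * w)⁻¹ = h * k * h⁻¹ * k⁻¹ := by
    have h1 : h * z * (k * w) = h * k * (z * w) := by
      rw [mul_assoc, ← mul_assoc z, ← hz k]; group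
    have h2 : (k * w) * (h * z) = k * h * (z * w) := by
      rw [mul_assoc, ← mul_assoc w, ← hw h, hw z]; group
    calc h * z * (k * w) * (h * z)⁻¹ * (k * w)⁻¹
        = (h * z * (k * w)) * ((k * w) * (h * z))⁻¹ := by group
      _ = h * k * h⁻¹ * k⁻¹ := by rw [h1, h2]; group
  rw [commutatorElement_def, e]
  exact H.mul_mem (H.mul_mem (H.mul_mem hh hk) (H.inv_mem hh)) (H.inv_mem hk)
end

section
/- Let ℓ be a prime and r ≥ 1. There exists an element g of the symplectic group Sp_{2r}(ℤ/ℓ) whose order is ℓ^r + 1 and whose natural action on (ℤ/ℓ)^{2r} is irreducible, i.e., the only subspaces of (ℤ/ℓ)^{2r} invariant under g are 0 and the whole space. -/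
open Module in
/-- An element of multiplicative order `ℓ^r+1` generates a field of degree `2r` over `𝔽_ℓ`. -/
lemma adjoin_top_aux (ℓ : ℕ) [Fact ℓ.Prime] (r : ℕ) (hr : 1 ≤ r) (K : Type) [Field K]
    [Finite K] [Algebra (ZMod ℓ) K] (hK : finrank (ZMod ℓ) K = 2 * r) (z : K)
    (hz : orderOf z = ℓ ^ r + 1) : Algebra.adjoin (ZMod ℓ) {z} = ⊤ := by
  have hint : IsIntegral (ZMod ℓ) z := Algebra.IsIntegral.isIntegral z
  set S := IntermediateField.adjoin (ZMod ℓ) {z} with hS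
  have hzS : z ∈ S := IntermediateField.mem_adjoin_simple_self _ z
  have hz0 : z ≠ 0 := by
    rintro rfl
    rw [orderOf_zero] at hz
    omega
  have hcard : Nat.card S = ℓ ^ finrank (ZMod ℓ) S := by
    rw [Module.natCard_eq_pow_finrank (K := ZMod ℓ), Nat.card_zmod]
  have hdvd : finrank (ZMod ℓ) S ∣ 2 * r := by
    rw [← hK, ← Module.finrank_mul_finrank (ZMod ℓ) S K]
    exact dvd_mul_right _ _
  have hpow : z ^ (Nat.card S - 1) = 1 := by
    have := Fintype.ofFinite S
    have h := FiniteField.pow_card_sub_one_eq_one (K := S) ⟨z, hzS⟩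
      (fun h => hz0 (congrArg Subtype.val h))
    rw [Nat.card_eq_fintype_card]
    exact congrArg Subtype.val h
  have h1 : ℓ ^ r + 1 ∣ Nat.card S - 1 := hz ▸ orderOf_dvd_of_pow_eq_one hpow
  have hgt : 1 < Nat.card S := Finite.one_lt_card
  have h2 := Nat.le_of_dvd (by omega) h1
  have h3 : ℓ ^ r < ℓ ^ finrank (ZMod ℓ) S := by omega
  have h4 : r < finrank (ZMod ℓ) S :=
    (Nat.pow_lt_pow_iff_right (Fact.out : ℓ.Prime).one_lt).1 h3
  have h5 : finrank (ZMod ℓ) S = 2 * r := by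
    obtain ⟨k, hk⟩ := hdvd
    rcases k with _ | _ | k
    · omega
    · omega
    · nlinarith
  have h6 : S = ⊤ := by
    apply IntermediateField.eq_of_le_of_finrank_eq le_top
    rw [h5, IntermediateField.finrank_top', hK]
  rw [← IntermediateField.adjoin_simple_toSubalgebra_of_isAlgebraic hint.isAlgebraic, ← hS, h6]
  rfl

/-- Subspaces stable under a field generator are trivial. -/
lemma stable_aux (k K : Type) [Field k] [Field K] [Algebra k K] (z : K)
    (hz : Algebra.adjoin k {z} = ⊤) (W : Submodule k K) (hW : ∀ v ∈ W, z * v ∈ W) :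
    W = ⊥ ∨ W = ⊤ := by
  by_cases hb : W = ⊥
  · exact Or.inl hb
  right
  obtain ⟨w, hw, hw0⟩ := Submodule.exists_mem_ne_zero_of_ne_bot hb
  have key : ∀ x : K, ∀ v ∈ W, x * v ∈ W := by
    intro x
    have hx : x ∈ Algebra.adjoin k {z} := by rw [hz]; trivial
    induction hx using Algebra.adjoin_induction with
    | mem x hx => rw [Set.mem_singleton_iff] at hx; subst hx; exact hW
    | algebraMap c => intro v hv; rw [← Algebra.smul_def]; exact W.smul_mem c hv
    | add x y _ _ h1 h2 => intro v hv; rw [add_mul]; exact W.add_mem (h1 v hv) (h2 v hv)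
    | mul x y _ _ h1 h2 => intro v hv; rw [mul_assoc]; exact h1 _ (h2 v hv)
  rw [eq_top_iff]
  intro x _
  have := key (x * w⁻¹) w hw
  rwa [mul_assoc, inv_mul_cancel₀ hw0, mul_one] at this

open Module in
/-- A symplectic basis of a quadratic extension `K / F`, for the form `Tr_{F/k} ∘ det_F`. -/
lemma basis_aux (k F K : Type) [Field k] [Field F] [Field K] [Algebra k F] [Algebra F K]
    [Algebra k K] [IsScalarTower k F K] [FiniteDimensional k F] [Algebra.IsSeparable k F] (r : ℕ)
    (hF : finrank k F = r) (hK : finrank F K = 2) :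
    ∃ (b : Basis (Fin r ⊕ Fin r) k K) (B : K →ₗ[k] K →ₗ[k] k),
      LinearMap.toMatrix₂ b b B = - Matrix.J (Fin r) k ∧
      ∀ z, Algebra.norm F z = 1 → ∀ x y, B (z * x) (z * y) = B x y := by
  have : FiniteDimensional F K := FiniteDimensional.of_finrank_pos (by omega)
  let c : Basis (Fin 2) F K := finBasisOfFinrankEq F K hK
  let e : Basis (Fin r) k F := finBasisOfFinrankEq k F hF
  let e' : Basis (Fin r) k F := (Algebra.traceForm k F).dualBasis (traceForm_nondegenerate k F) e
  have hee : ∀ i j, Algebra.trace k F (e i * e' j) = if i = j then 1 else 0 := fun i j =>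
    LinearMap.BilinForm.apply_dualBasis_right (traceForm_nondegenerate k F)
      (Algebra.traceForm_isSymm k) e i j
  let φ : K ≃ₗ[F] F × F := c.equivFun.trans (LinearEquiv.finTwoArrow F F)
  let b : Basis (Fin r ⊕ Fin r) k K := (e.prod e').map (φ.restrictScalars k).symm
  let B : K →ₗ[k] K →ₗ[k] k := LinearMap.mk₂ k
    (fun x y => Algebra.trace k F ((φ x).1 * (φ y).2 - (φ x).2 * (φ y).1))
    (fun x x' y => by rw [← map_add]; congr 1; simp only [map_add, Prod.fst_add, Prod.snd_add]; ring)
    (fun a x y => by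
      rw [← map_smul]; congr 1
      have : φ (a • x) = a • φ x := (φ.restrictScalars k).map_smul a x
      rw [this]; simp only [Prod.smul_fst, Prod.smul_snd, smul_mul_assoc, smul_sub])
    (fun x x' y => by rw [← map_add]; congr 1; simp only [map_add, Prod.fst_add, Prod.snd_add]; ring)
    (fun a x y => by
      rw [← map_smul]; congr 1
      have : φ (a • y) = a • φ y := (φ.restrictScalars k).map_smul a y
      rw [this]; simp only [Prod.smul_fst, Prod.smul_snd, mul_smul_comm, smul_sub])
  have hB : ∀ x y, B x y = Algebra.trace k F ((φ x).1 * (φ y).2 - (φ x).2 * (φ y).1) :=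
    fun x y => rfl
  have hdet : ∀ x y, (φ x).1 * (φ y).2 - (φ x).2 * (φ y).1 = c.det ![x, y] := by
    intro x y
    rw [Basis.det_apply, Matrix.det_fin_two]
    simp [φ, Basis.toMatrix_apply]
    ring
  have hb : ∀ i, φ (b i) = e.prod e' i := by
    intro i
    rw [Basis.map_apply]
    exact (φ.restrictScalars k).apply_symm_apply _
  refine ⟨b, B, ?_, ?_⟩
  · ext i j
    rw [LinearMap.toMatrix₂_apply, hB, hb, hb]
    rcases i with i | i <;> rcases j with j | j
    · simp [Matrix.J, Basis.prod_apply]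
    · simp [Matrix.J, Basis.prod_apply, hee, Matrix.one_apply]
    · simp [Matrix.J, Basis.prod_apply, mul_comm (e' i), hee, Matrix.one_apply, eq_comm]
    · simp [Matrix.J, Basis.prod_apply]
  · intro z hz x y
    rw [hB, hB, hdet, hdet]
    congr 1
    have := c.det_comp (Algebra.lmul F K z) ![x, y]
    rw [← Algebra.norm_apply, hz, one_mul] at this
    rw [← this]
    congr 1
    ext i
    fin_cases i <;> rfl

open Module in
/-- For a prime `ℓ` and `r ≥ 1`, there is an element of `Sp_{2r}(ℤ/ℓ)` of order `ℓ^r + 1`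
acting irreducibly on `(ℤ/ℓ)^{2r}`. -/
theorem stmt_11 (ℓ : ℕ) (hℓ : ℓ.Prime) (r : ℕ) (hr : 1 ≤ r) :
    ∃ g : Matrix.symplecticGroup (Fin r) (ZMod ℓ),
      orderOf g = ℓ ^ r + 1 ∧
      ∀ W : Submodule (ZMod ℓ) (Fin r ⊕ Fin r → ZMod ℓ),
        (∀ v ∈ W, Matrix.mulVec (g : Matrix (Fin r ⊕ Fin r) (Fin r ⊕ Fin r) (ZMod ℓ)) v ∈ W) →
        W = ⊥ ∨ W = ⊤ := by
  haveI : Fact ℓ.Prime := ⟨hℓ⟩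
  let F := GaloisField ℓ r
  let K := GaloisField ℓ (2 * r)
  have hF : finrank (ZMod ℓ) F = r := GaloisField.finrank ℓ (by omega)
  have hK : finrank (ZMod ℓ) K = 2 * r := GaloisField.finrank ℓ (by omega)
  have cF : Nat.card F = ℓ ^ r := GaloisField.card ℓ r (by omega)
  have cK : Nat.card K = ℓ ^ (2 * r) := GaloisField.card ℓ (2 * r) (by omega)
  haveI : Finite F := Nat.finite_of_card_ne_zero (by rw [cF]; exact (pow_pos hℓ.pos _).ne')
  haveI : Finite K := Nat.finite_of_card_ne_zero (by rw [cK]; exact (pow_pos hℓ.pos _).ne')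
  obtain ⟨f⟩ : Nonempty (F →ₐ[ZMod ℓ] K) :=
    FiniteField.nonempty_algHom_of_finrank_dvd (by rw [hF, hK]; exact dvd_mul_left _ _)
  letI : Algebra F K := f.toRingHom.toAlgebra
  haveI : IsScalarTower (ZMod ℓ) F K := IsScalarTower.of_algebraMap_eq fun x => (f.commutes x).symm
  have hFK : finrank F K = 2 := by
    have h := Module.finrank_mul_finrank (ZMod ℓ) F K
    rw [hF, hK, mul_comm] at h
    exact Nat.eq_of_mul_eq_mul_right (by omega) h
  -- the element of order `q + 1`
  have hq : 1 < ℓ ^ r := Nat.one_lt_pow (by omega) hℓ.one_lt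
  have hfac : ℓ ^ (2 * r) - 1 = (ℓ ^ r - 1) * (ℓ ^ r + 1) := by
    rw [mul_comm 2 r, pow_mul, mul_comm, ← Nat.sq_sub_sq, one_pow]
  obtain ⟨z, hz⟩ : ∃ z : K, orderOf z = ℓ ^ r + 1 := by
    obtain ⟨u, hu⟩ := IsCyclic.exists_generator (α := Kˣ)
    have hou : orderOf u = (ℓ ^ r - 1) * (ℓ ^ r + 1) := by
      rw [orderOf_eq_card_of_forall_mem_zpowers hu, Nat.card_units, cK, hfac]
    refine ⟨((u ^ (ℓ ^ r - 1) : Kˣ) : K), ?_⟩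
    rw [orderOf_units, orderOf_pow_of_dvd (by omega) (by rw [hou]; exact dvd_mul_right _ _), hou,
      Nat.mul_div_cancel_left _ (by omega)]
  have hnorm : Algebra.norm F z = 1 := by
    apply (algebraMap F K).injective
    rw [FiniteField.algebraMap_norm_eq_pow, cF, cK, hfac, Nat.mul_div_cancel_left _ (by omega),
      ← hz, pow_orderOf_eq_one, map_one]
  obtain ⟨b, B, hbB, hB⟩ := basis_aux (ZMod ℓ) F K r hF hFK
  let M := Algebra.leftMulMatrix b z
  have hM : M ∈ Matrix.symplecticGroup (Fin r) (ZMod ℓ) := by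
    rw [SymplecticGroup.mem_iff']
    have h := LinearMap.toMatrix₂_compl₁₂ b b b b B (Algebra.lmul (ZMod ℓ) K z)
      (Algebra.lmul (ZMod ℓ) K z)
    have h' : B.compl₁₂ (Algebra.lmul (ZMod ℓ) K z) (Algebra.lmul (ZMod ℓ) K z) = B := by
      ext x y
      exact hB z hnorm x y
    rw [h', hbB, ← Algebra.leftMulMatrix_apply b z] at h
    rw [Matrix.mul_neg, Matrix.neg_mul, neg_inj] at h
    exact h.symm
  refine ⟨⟨M, hM⟩, ?_, ?_⟩
  · rw [← orderOf_submonoid]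
    show orderOf (Algebra.leftMulMatrix b z) = _
    rw [← hz]
    exact orderOf_injective (Algebra.leftMulMatrix b).toMonoidHom
      (Algebra.leftMulMatrix_injective b) z
  · intro W hW
    have hmul : ∀ x, b.equivFun (z * x) = M.mulVec (b.equivFun x) := fun x =>
      (Algebra.leftMulMatrix_mulVec_repr b z x).symm
    have hst := stable_aux (ZMod ℓ) K z (adjoin_top_aux ℓ r hr K hK z hz)
      (W.comap b.equivFun.toLinearMap) (by
        intro v hv
        rw [Submodule.mem_comap] at hv ⊢
        have := hW _ hv
        exact (hmul v).symm ▸ this)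
    have hW' : W = (W.comap b.equivFun.toLinearMap).map b.equivFun.toLinearMap :=
      (Submodule.map_comap_eq_of_surjective b.equivFun.surjective W).symm
    rcases hst with h | h
    · left; rw [hW', h, Submodule.map_bot]
    · right; rw [hW', h, Submodule.map_top, LinearMap.range_eq_top]; exact b.equivFun.surjective
end

section
/- Fix integers r ≥ 1 and m ≥ 1. There exist a real constant C < 1 and a bound N such that for every prime ℓ > N the following holds: for every subgroup H of GL_{2r}(ℤ/ℓ) such that (i) H contains the symplectic group Sp_{2r}(ℤ/ℓ) and (ii) every h ∈ H satisfies hᵀJh = c·J for some scalar c ∈ (ℤ/ℓ)ˣ (depending on h), the number of elements h ∈ H such that h^m does NOT act irreducibly on (ℤ/ℓ)^{2r} is less than C · #H. -/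
open Matrix

lemma aux_embed (r ℓ : ℕ) (hr : 1 ≤ r) [Fact ℓ.Prime] (hℓ : ℓ ≠ 2) :
    ∃ (K : Type) (_ : Field K) (_ : Finite K) (_ : Algebra (ZMod ℓ) K)
      (B : Module.Basis (Fin r ⊕ Fin r) (ZMod ℓ) K) (N : K →* K),
      (∀ x, N x = 1 → (Algebra.leftMulMatrix B x)ᵀ * Matrix.fromBlocks 0 1 (-1) 0 *
        Algebra.leftMulMatrix B x = Matrix.fromBlocks 0 1 (-1) 0) ∧
      (ℓ ^ r + 1 ≤ Nat.card {x : Kˣ // N (x : K) = 1}) ∧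
      (∀ x : K, x ^ (ℓ ^ r) = x → N x = x ^ 2) := by
  classical
  let L := GaloisField ℓ r
  have : Finite L := inferInstance
  have : Fintype L := Fintype.ofFinite L
  have hcardL : Nat.card L = ℓ ^ r := GaloisField.card ℓ r (by omega)
  have hchar : ringChar L ≠ 2 := by
    rw [ringChar.eq L ℓ]; exact hℓ
  obtain ⟨D, hD⟩ := FiniteField.exists_nonsquare hchar
  have hfact : Fact (∀ s : L, s ^ 2 ≠ D + 0 * s) := ⟨fun s hs => hD ⟨s, by rw [← sq, hs]; ring⟩⟩
  let K := QuadraticAlgebra L D 0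
  have : Finite K := Finite.of_equiv _ (QuadraticAlgebra.equivProd D (0 : L)).symm
  have hcardK : Nat.card K = (ℓ ^ r) * ℓ ^ r := by
    rw [Nat.card_congr (QuadraticAlgebra.equivProd D (0 : L)), Nat.card_prod, hcardL]
  let e : K ≃ₗ[ZMod ℓ] L × L :=
    { QuadraticAlgebra.equivProd D (0 : L) with
      map_add' := fun x y => rfl
      map_smul' := fun c x => rfl }
  have hfin : Module.finrank (ZMod ℓ) L = r := GaloisField.finrank ℓ (by omega)
  let b : Module.Basis (Fin r) (ZMod ℓ) L := (Module.finBasis (ZMod ℓ) L).reindex (finCongr hfin)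
  have hnd := traceForm_nondegenerate (ZMod ℓ) L
  let b' := (Algebra.traceForm (ZMod ℓ) L).dualBasis hnd b
  have hb1 : ∀ i j, Algebra.trace (ZMod ℓ) L (b' i * b j) = if j = i then 1 else 0 := fun i j =>
    LinearMap.BilinForm.apply_dualBasis_left hnd b i j
  let B : Module.Basis (Fin r ⊕ Fin r) (ZMod ℓ) K := (b.prod b').map e.symm
  have ha1 : ∀ x y : K, (x + y).re = x.re + y.re := fun _ _ => rfl
  have ha2 : ∀ x y : K, (x + y).im = x.im + y.im := fun _ _ => rfl
  have hs1 : ∀ (c : ZMod ℓ) (x : K), (c • x).re = c • x.re := fun _ _ => rfl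
  have hs2 : ∀ (c : ZMod ℓ) (x : K), (c • x).im = c • x.im := fun _ _ => rfl
  have hm1 : ∀ x y : K, (x * y).re = x.re * y.re + D * x.im * y.im := fun _ _ => rfl
  have hm2 : ∀ x y : K, (x * y).im = x.re * y.im + x.im * y.re + 0 * x.im * y.im :=
    fun _ _ => rfl
  let om : LinearMap.BilinForm (ZMod ℓ) K := LinearMap.mk₂ (ZMod ℓ)
    (fun x y : K => Algebra.trace (ZMod ℓ) L (x.re * y.im - x.im * y.re))
    (by intro x y z; rw [← map_add]; congr 1; rw [ha1, ha2]; ring)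
    (by intro c x y; rw [← map_smul]; congr 1
        rw [hs1, hs2, smul_mul_assoc, smul_mul_assoc, smul_sub])
    (by intro x y z; rw [← map_add]; congr 1; rw [ha1, ha2]; ring)
    (by intro c x y; rw [← map_smul]; congr 1
        rw [hs1, hs2, mul_smul_comm, mul_smul_comm, smul_sub])
  have hgram : LinearMap.BilinForm.toMatrix B om = Matrix.fromBlocks 0 1 (-1) 0 := by
    ext i j
    rw [LinearMap.BilinForm.toMatrix_apply]
    change Algebra.trace (ZMod ℓ) L ((B i).re * (B j).im - (B i).im * (B j).re) = _
    have h1 : ∀ i, B (Sum.inl i) = ⟨b i, 0⟩ := by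
      intro i; simp [B]; rfl
    have h2 : ∀ i, B (Sum.inr i) = ⟨0, b' i⟩ := by
      intro i; simp [B]; rfl
    rcases i with i | i <;> rcases j with j | j
    · simp [h1]
    · simp [h1, h2, mul_comm (b i), hb1, Matrix.one_apply]
    · simp [h1, h2, hb1, Matrix.one_apply, eq_comm]
    · simp [h2]
  let N : K →* K := ((algebraMap L K : L →+* K) : L →* K).comp QuadraticAlgebra.norm
  have hNinj : Function.Injective (algebraMap L K) := QuadraticAlgebra.algebraMap_injective
  refine ⟨K, inferInstance, inferInstance, inferInstance, B, N, ?_, ?_, ?_⟩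
  · intro x hx
    have hx' : QuadraticAlgebra.norm x = 1 := hNinj (by rw [map_one]; exact hx)
    have hcomp : om.comp (LinearMap.mulLeft (ZMod ℓ) x) (LinearMap.mulLeft (ZMod ℓ) x) = om := by
      ext y z
      change Algebra.trace (ZMod ℓ) L ((x * y).re * (x * z).im - (x * y).im * (x * z).re) =
        Algebra.trace (ZMod ℓ) L (y.re * z.im - y.im * z.re)
      congr 1
      rw [QuadraticAlgebra.norm_def] at hx'
      have : y.re * z.im - y.im * z.re =
        (x.re * x.re + 0 * x.re * x.im - D * x.im * x.im) * (y.re * z.im - y.im * z.re) := by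
        rw [hx', one_mul]
      rw [this, hm1, hm1, hm2, hm2]
      ring
    have := LinearMap.BilinForm.toMatrix_comp B B om (LinearMap.mulLeft (ZMod ℓ) x)
      (LinearMap.mulLeft (ZMod ℓ) x)
    rw [hcomp, hgram] at this
    exact this.symm
  · let f : Kˣ →* Lˣ := Units.map QuadraticAlgebra.norm
    have h1 : Nat.card f.ker * Nat.card f.range = Nat.card Kˣ := by
      rw [← Subgroup.index_ker]; exact Subgroup.card_mul_index _
    have h2 : Nat.card f.range ≤ Nat.card Lˣ := Subgroup.card_le_card_group _
    have h3 : Nat.card Lˣ = ℓ ^ r - 1 := by rw [Nat.card_units, hcardL]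
    have h4 : Nat.card Kˣ = ℓ ^ r * ℓ ^ r - 1 := by rw [Nat.card_units, hcardK]
    have h5 : Nat.card f.ker = Nat.card {x : Kˣ // N (x : K) = 1} := by
      refine Nat.card_congr (Equiv.subtypeEquivRight fun x => ?_)
      rw [MonoidHom.mem_ker, Units.ext_iff]
      change QuadraticAlgebra.norm (x : K) = 1 ↔ algebraMap L K (QuadraticAlgebra.norm (x : K)) = 1
      rw [← map_one (algebraMap L K), hNinj.eq_iff]
    rw [← h5]
    have hq : 2 ≤ ℓ ^ r := (Fact.out : ℓ.Prime).two_le.trans (Nat.le_self_pow (by omega) _)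
    by_contra hlt
    push Not at hlt
    obtain ⟨k, hk⟩ := Nat.exists_eq_add_of_le hq
    rw [hk] at h3 h4 hlt
    have : Nat.card f.ker * Nat.card f.range ≤ (2 + k) * (2 + k - 1) :=
      Nat.mul_le_mul (by omega) (by omega)
    rw [h1, h4] at this
    have e1 : (2 + k) * (2 + k) - 1 = k * k + 4 * k + 3 := by
      have : (2 + k) * (2 + k) = k * k + 4 * k + 3 + 1 := by ring
      omega
    have e2 : 2 + k - 1 = k + 1 := by omega
    rw [e1, e2] at this
    nlinarith
  · intro x hx
    have hq : 1 < ℓ ^ r := (Fact.out : ℓ.Prime).one_lt.trans_le (Nat.le_self_pow (by omega) _)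
    have : ∃ a : L, algebraMap L K a = x := by
      by_contra hne
      push Not at hne
      let p : Polynomial K := Polynomial.X ^ (ℓ ^ r) - Polynomial.X
      have hp0 : p ≠ 0 := FiniteField.X_pow_card_sub_X_ne_zero K hq
      have hpd : p.natDegree = ℓ ^ r := FiniteField.X_pow_card_sub_X_natDegree_eq K hq
      have hsub : insert x (Finset.univ.image (algebraMap L K)) ⊆ p.roots.toFinset := by
        intro y hy
        rw [Multiset.mem_toFinset, Polynomial.mem_roots hp0, Polynomial.IsRoot.def]
        simp only [p, Polynomial.eval_sub, Polynomial.eval_pow, Polynomial.eval_X, sub_eq_zero]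
        rw [Finset.mem_insert, Finset.mem_image] at hy
        rcases hy with rfl | ⟨a, -, rfl⟩
        · exact hx
        · rw [← map_pow, ← hcardL, Nat.card_eq_fintype_card, FiniteField.pow_card]
      have h1 := Finset.card_le_card hsub
      rw [Finset.card_insert_of_notMem (by simpa using hne), Finset.card_image_of_injective _ hNinj,
        Finset.card_univ, ← Nat.card_eq_fintype_card, hcardL] at h1
      have h2 := (Multiset.toFinset_card_le p.roots).trans (Polynomial.card_roots' p)
      omega
    obtain ⟨a, rfl⟩ := this
    change algebraMap L K (QuadraticAlgebra.norm (algebraMap L K a)) = _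
    rw [QuadraticAlgebra.norm_algebraMap, map_pow]

lemma aux_deg {ℓ r : ℕ} [Fact ℓ.Prime] {K : Type} [Field K] [Finite K]
    [Algebra (ZMod ℓ) K] (hK : Module.finrank (ZMod ℓ) K = 2 * r) (hr : 1 ≤ r)
    (y : K) (hy : Algebra.adjoin (ZMod ℓ) {y} ≠ ⊤) :
    ∃ d ∈ Finset.Icc 1 r, y ^ (ℓ ^ d) = y := by
  have : Module.Finite (ZMod ℓ) K := Module.Finite.of_finite
  let E := IntermediateField.adjoin (ZMod ℓ) {y}
  have hE : E.toSubalgebra = Algebra.adjoin (ZMod ℓ) {y} :=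
    IntermediateField.adjoin_simple_toSubalgebra_of_isAlgebraic (Algebra.IsAlgebraic.isAlgebraic y)
  have hmul : Module.finrank (ZMod ℓ) E * Module.finrank E K = 2 * r := by
    rw [Module.finrank_mul_finrank, hK]
  have h1 : Module.finrank E K ≠ 1 := by
    intro h
    have : E = ⊤ := IntermediateField.finrank_eq_one_iff_eq_top.mp h
    apply hy
    rw [← hE, this, IntermediateField.top_toSubalgebra]
  refine ⟨Module.finrank (ZMod ℓ) E, ?_, ?_⟩
  · rw [Finset.mem_Icc]
    constructor
    · exact Module.finrank_pos
    · have : Module.finrank E K ≠ 0 := by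
        intro h; rw [h] at hmul; omega
      have : 2 ≤ Module.finrank E K := by omega
      nlinarith
  · have : Fintype E := Fintype.ofFinite E
    have hc : Fintype.card E = ℓ ^ Module.finrank (ZMod ℓ) E := by
      rw [Module.card_eq_pow_finrank (K := ZMod ℓ), ZMod.card]
    have := FiniteField.pow_card (⟨y, IntermediateField.mem_adjoin_simple_self _ y⟩ : E)
    rw [hc] at this
    exact congrArg Subtype.val this

lemma aux_roots {K : Type} [Field K] (a b : ℕ) (hab : b < a) (c : K) (s : Finset Kˣ)
    (h : ∀ x ∈ s, (x : K) ^ a = c * (x : K) ^ b) : s.card ≤ a := by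
  classical
  let p : Polynomial K := Polynomial.X ^ a - Polynomial.C c * Polynomial.X ^ b
  have hd : (Polynomial.C c * Polynomial.X ^ b).degree < ((Polynomial.X : Polynomial K) ^ a).degree := by
    rw [Polynomial.degree_X_pow]
    exact (Polynomial.degree_C_mul_X_pow_le _ _).trans_lt (by exact_mod_cast hab)
  have hpd : p.degree = a := by
    rw [Polynomial.degree_sub_eq_left_of_degree_lt hd, Polynomial.degree_X_pow]
  have hp0 : p ≠ 0 := by
    intro h0; rw [h0, Polynomial.degree_zero] at hpd; exact absurd hpd (by simp)
  have hnd : p.natDegree = a := Polynomial.natDegree_eq_of_degree_eq_some hpd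
  rw [← Finset.card_image_of_injective s (Units.val_injective (α := K))]
  calc _ ≤ p.roots.toFinset.card := by
        apply Finset.card_le_card
        intro y hy
        obtain ⟨x, hx, rfl⟩ := Finset.mem_image.mp hy
        rw [Multiset.mem_toFinset, Polynomial.mem_roots hp0, Polynomial.IsRoot.def]
        simp [p, h x hx]
    _ ≤ _ := (Multiset.toFinset_card_le p.roots).trans (Polynomial.card_roots' p)
    _ = a := hnd

lemma aux_bad {ℓ r m : ℕ} [Fact ℓ.Prime] {K : Type} [Field K] [Finite K]
    [Algebra (ZMod ℓ) K] (hK : Module.finrank (ZMod ℓ) K = 2 * r) (hr : 1 ≤ r) (hm : 1 ≤ m)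
    (hℓ : 2 * ((r + 2) * m) < ℓ) (N : K →* K)
    (hN1 : ℓ ^ r + 1 ≤ Nat.card {x : Kˣ // N (x : K) = 1})
    (hN2 : ∀ x : K, x ^ (ℓ ^ r) = x → N x = x ^ 2)
    (T : Subgroup Kˣ) (hT : ∀ x : Kˣ, N (x : K) = 1 → x ∈ T) :
    2 * Nat.card {t : Kˣ // t ∈ T ∧ Algebra.adjoin (ZMod ℓ) {(t : K) ^ m} ≠ ⊤} ≤ Nat.card T := by
  classical
  have : Fintype Kˣ := Fintype.ofFinite _
  let TS : Finset Kˣ := Finset.univ.filter (· ∈ T)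
  let TB : Finset Kˣ := Finset.univ.filter
    (fun t => t ∈ T ∧ Algebra.adjoin (ZMod ℓ) {(t : K) ^ m} ≠ ⊤)
  have e1 : Nat.card T = TS.card := by
    rw [Nat.card_eq_fintype_card]; exact Fintype.card_subtype _
  have e2 : Nat.card {t : Kˣ // t ∈ T ∧ Algebra.adjoin (ZMod ℓ) {(t : K) ^ m} ≠ ⊤} = TB.card := by
    rw [Nat.card_eq_fintype_card]; exact Fintype.card_subtype _
  rw [e1, e2]
  have hsub : TB ⊆ TS := by
    intro t ht
    simp only [TB, TS, Finset.mem_filter] at ht ⊢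
    exact ⟨ht.1, ht.2.1⟩
  let f : Kˣ → K := fun x => N x
  have hlow : (ℓ ^ r + 1) * (TS.image f).card ≤ TS.card := by
    apply Finset.mul_card_image_le_card
    intro b hb
    obtain ⟨x, hx, rfl⟩ := Finset.mem_image.mp hb
    refine hN1.trans ?_
    rw [Nat.card_eq_fintype_card, Fintype.card_subtype]
    apply Finset.card_le_card_of_injOn (fun y => x * y)
    · intro y hy
      simp only [Finset.coe_filter, Set.mem_ofPred_eq, Finset.mem_univ, true_and] at hy
      simp only [TS, Finset.coe_filter, Set.mem_ofPred_eq, Finset.mem_univ, true_and,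
        Finset.mem_filter] at hx ⊢
      refine ⟨T.mul_mem hx (hT y hy), ?_⟩
      simp [f, hy]
    · intro y _ z _ h
      exact mul_left_cancel h
  have hℓ1 : 1 < ℓ := (Fact.out : ℓ.Prime).one_lt
  have hup : TB.card ≤ ((r + 2) * m * ℓ ^ (r - 1)) * (TS.image f).card := by
    apply Finset.card_le_mul_card_image_of_maps_to (f := f)
    · intro a ha
      exact Finset.mem_image_of_mem _ (hsub ha)
    · intro b _
      let S : ℕ → Finset Kˣ := fun d => Finset.univ.filter
        (fun x : Kˣ => f x = b ∧ ((x : K) ^ m) ^ (ℓ ^ d) = (x : K) ^ m)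
      have hcov : TB.filter (fun a => f a = b) ⊆ (Finset.Icc 1 r).biUnion S := by
        intro x hx
        simp only [TB, Finset.mem_filter, Finset.mem_univ, true_and] at hx
        obtain ⟨d, hd, hd'⟩ := aux_deg hK hr _ hx.1.2
        rw [Finset.mem_biUnion]
        exact ⟨d, hd, by simp [S, hx.2, hd']⟩
      have hS : ∀ d ∈ Finset.Icc 1 r, (S d).card ≤ (if d = r then 2 * m else 0) + m * ℓ ^ (r - 1) := by
        intro d hd
        rw [Finset.mem_Icc] at hd
        by_cases hdr : d = r
        · rw [if_pos hdr]
          refine le_trans ?_ (Nat.le_add_right _ _)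
          apply aux_roots (2 * m) 0 (by omega) (b ^ m)
          intro x hx
          simp only [S, Finset.mem_filter, Finset.mem_univ, true_and, hdr] at hx
          have := hN2 _ hx.2
          rw [pow_zero, mul_one, ← hx.1, mul_comm 2 m, pow_mul, ← this, map_pow]
        · rw [if_neg hdr, zero_add]
          calc (S d).card ≤ m * ℓ ^ d := by
                apply aux_roots (m * ℓ ^ d) m ?_ 1
                · intro x hx
                  simp only [S, Finset.mem_filter, Finset.mem_univ, true_and] at hx
                  rw [one_mul, pow_mul, hx.2]
                · have : 1 < ℓ ^ d := Nat.one_lt_pow (by omega) hℓ1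
                  nlinarith
            _ ≤ _ := Nat.mul_le_mul_left _ (Nat.pow_le_pow_right (by omega) (by omega))
      calc _ ≤ _ := Finset.card_le_card hcov
        _ ≤ _ := Finset.card_biUnion_le
        _ ≤ _ := Finset.sum_le_sum hS
        _ = 2 * m + r * (m * ℓ ^ (r - 1)) := by
          rw [Finset.sum_add_distrib, Finset.sum_ite_eq', Finset.sum_const, Nat.card_Icc,
            if_pos (by simp [hr])]
          simp
        _ ≤ _ := by
          have : 1 ≤ ℓ ^ (r - 1) := Nat.one_le_pow _ _ (by omega)
          nlinarith [Nat.mul_le_mul_left (2 * m) this]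
  have hpow : ℓ ^ r = ℓ * ℓ ^ (r - 1) := by
    rw [← pow_succ']; congr 1; omega
  calc 2 * TB.card ≤ 2 * (((r + 2) * m * ℓ ^ (r - 1)) * (TS.image f).card) :=
        Nat.mul_le_mul_left _ hup
    _ = (2 * ((r + 2) * m)) * ℓ ^ (r - 1) * (TS.image f).card := by ring
    _ ≤ (ℓ ^ r + 1) * (TS.image f).card := by
        apply Nat.mul_le_mul_right
        rw [hpow]
        exact (Nat.mul_le_mul_right _ hℓ.le).trans (Nat.le_succ _)
    _ ≤ _ := hlow

/-- A square matrix acts irreducibly. -/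
def MatIrr {n F : Type} [Fintype n] [Field F] (A : Matrix n n F) : Prop :=
  ∀ W : Submodule F (n → F), (∀ v ∈ W, Matrix.mulVec A v ∈ W) → W = ⊥ ∨ W = ⊤

lemma aux_irr {n F K : Type} [Fintype n] [DecidableEq n] [Field F] [Field K] [Algebra F K]
    (B : Module.Basis n F K) (y : K) (hy : Algebra.adjoin F {y} = ⊤) :
    MatIrr (Algebra.leftMulMatrix B y) := by
  intro W hW
  by_cases hb : W = ⊥
  · exact Or.inl hb
  right
  obtain ⟨w, hw, hw0⟩ := (Submodule.ne_bot_iff W).mp hb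
  have key : ∀ a : K, ∀ v ∈ W, Matrix.mulVec (Algebra.leftMulMatrix B a) v ∈ W := by
    intro a
    have ha : a ∈ Algebra.adjoin F {y} := by rw [hy]; trivial
    induction ha using Algebra.adjoin_induction with
    | mem x hx => rw [Set.mem_singleton_iff] at hx; subst hx; exact hW
    | algebraMap c =>
      intro v hv
      rw [AlgHom.commutes, Algebra.algebraMap_eq_smul_one, Matrix.smul_mulVec, Matrix.one_mulVec]
      exact W.smul_mem _ hv
    | add x z _ _ hx hz =>
      intro v hv
      rw [map_add, Matrix.add_mulVec]
      exact W.add_mem (hx v hv) (hz v hv)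
    | mul x z _ _ hx hz =>
      intro v hv
      rw [map_mul, ← Matrix.mulVec_mulVec]
      exact hx _ (hz v hv)
  rw [eq_top_iff]
  intro v _
  let k := B.equivFun.symm w
  have hk : B.repr k = w := B.equivFun.apply_symm_apply w
  have hk0 : k ≠ 0 := by
    intro h; apply hw0; rw [← hk, h]; simp
  let u := B.equivFun.symm v
  have hu : B.repr u = v := B.equivFun.apply_symm_apply v
  have h1 := key (u * k⁻¹) w hw
  rw [← hk, Algebra.leftMulMatrix_mulVec_repr, inv_mul_cancel_right₀ hk0, hu] at h1
  exact h1

lemma aux_conj {n F : Type} [Fintype n] [DecidableEq n] [Field F]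
    (A : Matrix n n F) (g : GL n F) (hA : MatIrr A) :
    MatIrr ((g : Matrix n n F) * A * ((g⁻¹ : GL n F) : Matrix n n F)) := by
  intro W hW
  have hgi : ((g⁻¹ : GL n F) : Matrix n n F) * (g : Matrix n n F) = 1 := g.inv_mul
  have hgi' : (g : Matrix n n F) * ((g⁻¹ : GL n F) : Matrix n n F) = 1 := g.mul_inv
  have h := hA (W.comap (Matrix.mulVecLin (g : Matrix n n F))) (by
    intro v hv
    rw [Submodule.mem_comap, Matrix.mulVecLin_apply] at hv ⊢
    have := hW _ hv
    rwa [Matrix.mulVec_mulVec, mul_assoc, hgi, mul_one, ← Matrix.mulVec_mulVec] at this)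
  have back : ∀ v, v ∈ W ↔ Matrix.mulVec ((g⁻¹ : GL n F) : Matrix n n F) v ∈
      W.comap (Matrix.mulVecLin (g : Matrix n n F)) := by
    intro v
    rw [Submodule.mem_comap, Matrix.mulVecLin_apply, Matrix.mulVec_mulVec, hgi', Matrix.one_mulVec]
  rcases h with h | h
  · left
    rw [eq_bot_iff]
    intro v hv
    rw [back, h, Submodule.mem_bot] at hv
    rw [Submodule.mem_bot, ← Matrix.one_mulVec v, ← hgi', ← Matrix.mulVec_mulVec, hv,
      Matrix.mulVec_zero]
  · right
    rw [eq_top_iff]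
    intro v _
    rw [back, h]
    trivial

lemma aux_cent {n F K : Type} [Fintype n] [DecidableEq n] [Field F] [Field K] [Algebra F K]
    (B : Module.Basis n F K) (t : K) (m : ℕ) (ht : Algebra.adjoin F {t ^ m} = ⊤)
    (g : GL n F) (hg : (g : Matrix n n F) * Algebra.leftMulMatrix B t =
      Algebra.leftMulMatrix B t * (g : Matrix n n F)) :
    ∃ s : Kˣ, Units.map (Algebra.leftMulMatrix B : K →* Matrix n n F) s = g := by
  have key : ∀ a : K, (g : Matrix n n F) * Algebra.leftMulMatrix B a =
      Algebra.leftMulMatrix B a * (g : Matrix n n F) := by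
    intro a
    have ha : a ∈ Algebra.adjoin F {t ^ m} := by rw [ht]; trivial
    induction ha using Algebra.adjoin_induction with
    | mem x hx =>
      rw [Set.mem_singleton_iff] at hx; subst hx
      rw [map_pow]
      exact Commute.pow_right hg m
    | algebraMap c =>
      rw [AlgHom.commutes]; exact (Algebra.commutes c _).symm
    | add x z _ _ hx hz => rw [map_add, mul_add, add_mul, hx, hz]
    | mul x z _ _ hx hz => rw [map_mul, ← mul_assoc, hx, mul_assoc, hz, mul_assoc]
  let s := B.equivFun.symm (Matrix.mulVec (g : Matrix n n F) (B.repr 1))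
  have hs : B.repr s = Matrix.mulVec (g : Matrix n n F) (B.repr 1) :=
    B.equivFun.apply_symm_apply _
  have hsg : Algebra.leftMulMatrix B s = (g : Matrix n n F) := by
    apply Matrix.mulVec_injective
    funext v
    let u := B.equivFun.symm v
    have hu : B.repr u = v := B.equivFun.apply_symm_apply v
    rw [← hu, Algebra.leftMulMatrix_mulVec_repr, mul_comm,
      ← Algebra.leftMulMatrix_mulVec_repr, hs, Matrix.mulVec_mulVec, ← key, ← Matrix.mulVec_mulVec,
      Algebra.leftMulMatrix_mulVec_repr, mul_one]
  have hs0 : s ≠ 0 := by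
    intro h0
    rw [h0, map_zero] at hsg
    have h1 : ((g⁻¹ : GL n F) : Matrix n n F) * (g : Matrix n n F) = 1 := g.inv_mul
    rw [← hsg, mul_zero, ← map_one (Algebra.leftMulMatrix B),
      ← map_zero (Algebra.leftMulMatrix B)] at h1
    exact zero_ne_one (Algebra.leftMulMatrix_injective B h1)
  exact ⟨Units.mk0 s hs0, Units.ext hsg⟩

lemma aux_root {n F K : Type} [Fintype n] [DecidableEq n] [Field F] [Field K] [Algebra F K]
    (B : Module.Basis n F K) (t : Kˣ) (g y : GL n F)
    (h : g * Units.map (Algebra.leftMulMatrix B : K →* Matrix n n F) t * g⁻¹ = y) :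
    Polynomial.aeval (t : K) (y : Matrix n n F).charpoly = 0 := by
  have hch : (y : Matrix n n F).charpoly = (Algebra.leftMulMatrix B (t : K)).charpoly := by
    have h2 := congrArg Units.val h
    rw [Units.val_mul, Units.val_mul, Matrix.coe_units_inv] at h2
    rw [← h2]
    exact Matrix.charpoly_units_conj g (Algebra.leftMulMatrix B (t : K))
  apply Algebra.leftMulMatrix_injective B
  rw [map_zero, ← Polynomial.aeval_algHom_apply, hch, Matrix.aeval_self_charpoly]

set_option maxHeartbeats 1000000 in
lemma aux_count {n F K : Type} [Fintype n] [DecidableEq n] [Field F] [Finite F]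
    [Field K] [Finite K] [Algebra F K]
    (B : Module.Basis n F K) (m : ℕ) (H : Subgroup (GL n F)) :
    Nat.card H * Nat.card {t : Kˣ //
        t ∈ H.comap (Units.map (Algebra.leftMulMatrix B : K →* Matrix n n F)) ∧
        Algebra.adjoin F {(t : K) ^ m} = ⊤} ≤
      (Nat.card (H.comap (Units.map (Algebra.leftMulMatrix B : K →* Matrix n n F))) *
        Fintype.card n) *
        Nat.card {h : GL n F // h ∈ H ∧ MatIrr ((h ^ m : GL n F) : Matrix n n F)} := by
  classical
  have : Fintype Kˣ := Fintype.ofFinite _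
  have : Fintype (GL n F) := Fintype.ofFinite _
  set φ : Kˣ →* GL n F := Units.map (Algebra.leftMulMatrix B : K →* Matrix n n F) with hφ
  have hφv : ∀ t : Kˣ, ((φ t : GL n F) : Matrix n n F) = Algebra.leftMulMatrix B (t : K) :=
    fun t => rfl
  have hφinj : Function.Injective φ := by
    intro a b hab
    apply Units.ext
    apply Algebra.leftMulMatrix_injective B
    rw [← hφv, ← hφv, hab]
  let HS : Finset (GL n F) := Finset.univ.filter (· ∈ H)
  let TS : Finset Kˣ := Finset.univ.filter (· ∈ H.comap φ)
  let TG : Finset Kˣ := Finset.univ.filter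
    (fun t => t ∈ H.comap φ ∧ Algebra.adjoin F {(t : K) ^ m} = ⊤)
  let HG : Finset (GL n F) := Finset.univ.filter
    (fun h => h ∈ H ∧ MatIrr ((h ^ m : GL n F) : Matrix n n F))
  have e1 : Nat.card H = HS.card := by
    rw [Nat.card_eq_fintype_card]; exact Fintype.card_subtype _
  have e2 : Nat.card (H.comap φ) = TS.card := by
    rw [Nat.card_eq_fintype_card]; exact Fintype.card_subtype _
  have e3 : Nat.card {t : Kˣ // t ∈ H.comap φ ∧ Algebra.adjoin F {(t : K) ^ m} = ⊤} = TG.card := by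
    rw [Nat.card_eq_fintype_card]; exact Fintype.card_subtype _
  have e4 : Nat.card {h : GL n F // h ∈ H ∧ MatIrr ((h ^ m : GL n F) : Matrix n n F)} =
      HG.card := by
    rw [Nat.card_eq_fintype_card]; exact Fintype.card_subtype _
  rw [e1, e2, e3, e4, ← Finset.card_product]
  apply Finset.card_le_mul_card_image_of_maps_to (f := fun p : GL n F × Kˣ => p.1 * φ p.2 * p.1⁻¹)
  · rintro ⟨g, t⟩ hp
    simp only [HS, TG, HG, Finset.mem_product, Finset.mem_filter, Finset.mem_univ, true_and,
      Subgroup.mem_comap] at hp ⊢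
    refine ⟨H.mul_mem (H.mul_mem hp.1 hp.2.1) (H.inv_mem hp.1), ?_⟩
    rw [conj_pow, Units.val_mul, Units.val_mul]
    apply aux_conj
    rw [← map_pow, hφv, Units.val_pow_eq_pow_val]
    exact aux_irr B _ hp.2.2
  · intro y _
    let p : Polynomial F := (y : Matrix n n F).charpoly
    have hpm : p.Monic := Matrix.charpoly_monic _
    let q : Polynomial K := p.map (algebraMap F K)
    have hq0 : q ≠ 0 := (hpm.map _).ne_zero
    let R : Finset Kˣ := Finset.univ.filter (fun t => (t : K) ∈ q.roots)
    have hR : R.card ≤ Fintype.card n := by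
      rw [← Finset.card_image_of_injective R (Units.val_injective (α := K))]
      calc _ ≤ q.roots.toFinset.card := by
            apply Finset.card_le_card
            intro z hz
            obtain ⟨x, hx, rfl⟩ := Finset.mem_image.mp hz
            simp only [R, Finset.mem_filter] at hx
            exact Multiset.mem_toFinset.mpr hx.2
        _ ≤ _ := (Multiset.toFinset_card_le q.roots).trans (Polynomial.card_roots' q)
        _ = _ := by rw [hpm.natDegree_map, Matrix.charpoly_natDegree_eq_dim]
    refine le_trans ?_ (Nat.mul_le_mul_left _ hR)
    apply Finset.card_le_mul_card_image_of_maps_to (f := Prod.snd)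
    · rintro ⟨g, t⟩ hp
      simp only [Finset.mem_filter] at hp
      simp only [R, Finset.mem_filter, Finset.mem_univ, true_and]
      rw [Polynomial.mem_roots hq0, Polynomial.IsRoot.def, Polynomial.eval_map_algebraMap]
      exact aux_root B t g y hp.2
    · intro t _
      rcases Finset.eq_empty_or_nonempty (Finset.filter (fun a : GL n F × Kˣ => a.2 = t)
        (Finset.filter (fun a : GL n F × Kˣ => a.1 * φ a.2 * a.1⁻¹ = y) (HS ×ˢ TG))) with h | h
      · rw [h]; simp
      · obtain ⟨⟨g0, t0⟩, h0⟩ := h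
        simp only [HS, TG, Finset.mem_filter, Finset.mem_product, Finset.mem_univ, true_and,
          Subgroup.mem_comap] at h0
        obtain ⟨⟨⟨hg0, ht0, htg⟩, h0y⟩, rfl⟩ := h0
        rw [← Finset.card_image_of_injective TS hφinj]
        apply Finset.card_le_card_of_injOn (fun a => g0⁻¹ * a.1)
        · rintro ⟨g, s⟩ hgs
          rw [Finset.mem_coe] at hgs
          simp only [HS, TG, Finset.mem_filter, Finset.mem_product, Finset.mem_univ, true_and,
            Subgroup.mem_comap] at hgs
          obtain ⟨⟨⟨hg, -, -⟩, hy⟩, rfl⟩ := hgs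
          have hcomm : g0⁻¹ * g * φ s = φ s * (g0⁻¹ * g) := by
            have h2 : g * φ s * g⁻¹ = g0 * φ s * g0⁻¹ := hy.trans h0y.symm
            have h3 : g * φ s = g0 * φ s * g0⁻¹ * g := by rw [← h2]; group
            rw [mul_assoc, h3]; group
          obtain ⟨u, hu⟩ := aux_cent B (s : K) m htg (g0⁻¹ * g) (congrArg Units.val hcomm)
          rw [Finset.mem_coe, Finset.mem_image]
          refine ⟨u, ?_, hu⟩
          simp only [TS, Finset.mem_filter, Finset.mem_univ, true_and, Subgroup.mem_comap]
          change φ u = _ at hu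
          rw [hu]
          exact H.mul_mem (H.inv_mem hg0) hg
        · rintro ⟨g, s⟩ hgs ⟨g', s'⟩ hgs' hE
          rw [Finset.mem_coe, Finset.mem_filter] at hgs hgs'
          have h1 := hgs.2
          have h2 := hgs'.2
          simp only at h1 h2 hE
          rw [h1, h2, mul_left_cancel hE]

lemma aux_split {α : Type} [Finite α] (S : Set α) (P : α → Prop) :
    Nat.card {t : α // t ∈ S ∧ P t} + Nat.card {t : α // t ∈ S ∧ ¬ P t} = Nat.card S := by
  classical
  rw [← Nat.card_sum]
  refine (Nat.card_congr ?_)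
  exact (Equiv.sumCongr (Equiv.subtypeSubtypeEquivSubtypeInter (· ∈ S) P).symm
    (Equiv.subtypeSubtypeEquivSubtypeInter (· ∈ S) (fun x => ¬ P x)).symm).trans
    (Equiv.sumCompl (fun x : S => P x))

lemma aux_final (r : ℕ) (hr : 1 ≤ r) (h hg hb t tg tb : ℕ) (ht : 0 < t) (hh : 0 < h)
    (hc : h * tg ≤ t * (2 * r) * hg) (hbad : 2 * tb ≤ t) (hts : tg + tb = t)
    (hhs : hg + hb = h) : (hb : ℝ) < (1 - 1 / (8 * r)) * h := by
  have h1 : h ≤ 4 * r * hg := by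
    have : h * t ≤ 4 * r * hg * t := by
      calc h * t ≤ h * (2 * tg) := Nat.mul_le_mul_left _ (by omega)
        _ = 2 * (h * tg) := by ring
        _ ≤ 2 * (t * (2 * r) * hg) := Nat.mul_le_mul_left _ hc
        _ = _ := by ring
    exact Nat.le_of_mul_le_mul_right this ht
  have hr0 : (0 : ℝ) < r := by exact_mod_cast hr
  have h2 : (h : ℝ) ≤ 4 * r * hg := by exact_mod_cast h1
  have h3 : (hg : ℝ) + hb = h := by exact_mod_cast hhs
  have h4 : (0 : ℝ) < h := by exact_mod_cast hh
  have h5 : 1 / (8 * (r : ℝ)) * h < hg := by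
    rw [div_mul_eq_mul_div, one_mul, div_lt_iff₀ (by positivity)]
    nlinarith
  linarith

/-- Case (D) of Lemma 1.1: for fixed `r, m ≥ 1` there are `C < 1` and `N` such that for
every prime `ℓ > N` and every subgroup `H` of `GL_{2r}(ℤ/ℓ)` with
`Sp_{2r}(ℤ/ℓ) ⊆ H ⊆ GSp_{2r}(ℤ/ℓ)`, the number of `h ∈ H` whose `m`-th power fails to act
irreducibly on `(ℤ/ℓ)^{2r}` is less than `C * #H`. -/
theorem stmt_13 (r m : ℕ) (hr : 1 ≤ r) (hm : 1 ≤ m) :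
    ∃ C : ℝ, C < 1 ∧ ∃ N : ℕ, ∀ ℓ : ℕ, ℓ.Prime → N < ℓ →
      ∀ H : Subgroup (Matrix.GeneralLinearGroup (Fin r ⊕ Fin r) (ZMod ℓ)),
        (∀ A : Matrix (Fin r ⊕ Fin r) (Fin r ⊕ Fin r) (ZMod ℓ),
          Aᵀ * Matrix.fromBlocks 0 1 (-1) 0 * A = Matrix.fromBlocks 0 1 (-1) 0 →
          ∃ h ∈ H, (h : Matrix (Fin r ⊕ Fin r) (Fin r ⊕ Fin r) (ZMod ℓ)) = A) →
        (∀ h ∈ H, ∃ c : (ZMod ℓ)ˣ,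
          (h : Matrix (Fin r ⊕ Fin r) (Fin r ⊕ Fin r) (ZMod ℓ))ᵀ *
              Matrix.fromBlocks 0 1 (-1) 0 *
              (h : Matrix (Fin r ⊕ Fin r) (Fin r ⊕ Fin r) (ZMod ℓ)) =
            (c : ZMod ℓ) • Matrix.fromBlocks 0 1 (-1) 0) →
        (Nat.card {h : H // ¬ ∀ W : Submodule (ZMod ℓ) (Fin r ⊕ Fin r → ZMod ℓ),
            (∀ v ∈ W, Matrix.mulVec
              (((h : Matrix.GeneralLinearGroup (Fin r ⊕ Fin r) (ZMod ℓ)) ^ m :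
                Matrix.GeneralLinearGroup (Fin r ⊕ Fin r) (ZMod ℓ)) :
                Matrix (Fin r ⊕ Fin r) (Fin r ⊕ Fin r) (ZMod ℓ)) v ∈ W) →
            W = ⊥ ∨ W = ⊤} : ℝ) < C * Nat.card H := by
  have hr0 : (0 : ℝ) < r := by exact_mod_cast hr
  refine ⟨1 - 1 / (8 * r), by simp; positivity, 2 * ((r + 2) * m), ?_⟩
  intro ℓ hp hN H hSp _
  have : Fact ℓ.Prime := ⟨hp⟩
  have hℓ2 : ℓ ≠ 2 := by
    have : 1 ≤ (r + 2) * m := Nat.mul_pos (by omega) hm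
    have : 3 * 1 ≤ (r + 2) * m := Nat.mul_le_mul (by omega) hm
    omega
  obtain ⟨K, _, _, _, B, N, h1, h2, h3⟩ := aux_embed r ℓ hr hℓ2
  have hK : Module.finrank (ZMod ℓ) K = 2 * r := by
    rw [Module.finrank_eq_card_basis B]; simp; ring
  have hcount := aux_count B m H
  set T := H.comap (Units.map (Algebra.leftMulMatrix B :
    K →* Matrix (Fin r ⊕ Fin r) (Fin r ⊕ Fin r) (ZMod ℓ))) with hTdef
  have hT : ∀ x : Kˣ, N (x : K) = 1 → x ∈ T := by
    intro x hx
    obtain ⟨h, hH, hh⟩ := hSp _ (h1 x hx)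
    rw [hTdef, Subgroup.mem_comap]
    have : Units.map (Algebra.leftMulMatrix B :
        K →* Matrix (Fin r ⊕ Fin r) (Fin r ⊕ Fin r) (ZMod ℓ)) x = h := Units.ext hh.symm
    rw [this]; exact hH
  have hbad := aux_bad hK hr hm hN N h2 h3 T hT
  have hTsum := aux_split T.carrier (fun t : Kˣ => Algebra.adjoin (ZMod ℓ) {(t : K) ^ m} = ⊤)
  have hHsum := aux_split H.carrier
    (fun h : GL (Fin r ⊕ Fin r) (ZMod ℓ) => MatIrr ((h ^ m : GL (Fin r ⊕ Fin r) (ZMod ℓ)) : Matrix (Fin r ⊕ Fin r) (Fin r ⊕ Fin r) (ZMod ℓ)))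
  have hgoal : Nat.card {h : H // ¬ ∀ W : Submodule (ZMod ℓ) (Fin r ⊕ Fin r → ZMod ℓ),
            (∀ v ∈ W, Matrix.mulVec
              (((h : Matrix.GeneralLinearGroup (Fin r ⊕ Fin r) (ZMod ℓ)) ^ m :
                Matrix.GeneralLinearGroup (Fin r ⊕ Fin r) (ZMod ℓ)) :
                Matrix (Fin r ⊕ Fin r) (Fin r ⊕ Fin r) (ZMod ℓ)) v ∈ W) →
            W = ⊥ ∨ W = ⊤} = Nat.card {h : GL (Fin r ⊕ Fin r) (ZMod ℓ) // h ∈ H.carrier ∧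
              ¬ MatIrr ((h ^ m : GL (Fin r ⊕ Fin r) (ZMod ℓ)) : Matrix (Fin r ⊕ Fin r) (Fin r ⊕ Fin r) (ZMod ℓ))} :=
    Nat.card_congr (Equiv.subtypeSubtypeEquivSubtypeInter (fun h => h ∈ H)
      (fun h => ¬ MatIrr ((h ^ m : GL (Fin r ⊕ Fin r) (ZMod ℓ)) : Matrix (Fin r ⊕ Fin r) (Fin r ⊕ Fin r) (ZMod ℓ))))
  rw [hgoal]
  have hTpos : 0 < Nat.card T := Nat.card_pos
  have hHpos : 0 < Nat.card H := Nat.card_pos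
  change _ + _ = Nat.card T at hTsum
  change _ + _ = Nat.card H at hHsum
  have hn : Fintype.card (Fin r ⊕ Fin r) = 2 * r := by simp; ring
  rw [hn] at hcount
  exact aux_final r hr _ _ _ _ _ _ hTpos hHpos hcount hbad hTsum hHsum
end
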